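/- arXiv:2510.21952 — 7 statements merged into one kernel-verified Lean document; each statement's English description precedes it below -/
import Mathlib

section
/- For every matrix A ∈ ℝ^{d×d}, every V ∈ ℝ^{d×k}, and every integer p ≥ 1, the identity tr( (Σ_{i=0}^{2p−1} (I_k − VᵀV)^i) · Vᵀ A V ) = tr(A) − tr((I_d − V Vᵀ)^{2p} A) holds; equivalently, the original OMM-p objective −tr(Q_p Vᵀ A V) with Q_p := Σ_{i=0}^{2p−1} (I_k − VᵀV)^i equals tr((I_d − V Vᵀ)^{2p} A) − tr(A). -/
open Matrix

theorem Matrix.mul_one_sub_mul_pow {m n R : Type*} [Fintype m] [Fintype n] [DecidableEq m]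
    [DecidableEq n] [Ring R] (V : Matrix m n R) (W : Matrix n m R) (i : ℕ) :
    V * (1 - W * V) ^ i = (1 - V * W) ^ i * V := by
  induction i with
  | zero => simp
  | succ i ih =>
    rw [pow_succ, ← Matrix.mul_assoc, ih, pow_succ, Matrix.mul_assoc, Matrix.mul_assoc]
    simp only [Matrix.mul_sub, Matrix.sub_mul, Matrix.mul_one, Matrix.one_mul, Matrix.mul_assoc]

theorem Matrix.mul_geom_sum_one_sub_mul {m n R : Type*} [Fintype m] [Fintype n] [DecidableEq m]
    [DecidableEq n] [Ring R] (V : Matrix m n R) (W : Matrix n m R) (N : ℕ) :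
    V * (∑ i ∈ Finset.range N, (1 - W * V) ^ i) * W = 1 - (1 - V * W) ^ N := by
  rw [Matrix.mul_sum, Finset.sum_congr rfl fun i _ => V.mul_one_sub_mul_pow W i,
    ← Matrix.sum_mul, Matrix.mul_assoc, ← geom_sum_mul_neg, sub_sub_cancel]

/-- The original OMM-p objective `−tr(Q_p Vᵀ A V)` with
`Q_p := Σ_{i=0}^{2p−1} (I_k − VᵀV)^i` equals `tr((I_d − V Vᵀ)^{2p} A) − tr(A)`;
equivalently, `tr(Q_p Vᵀ A V) = tr(A) − tr((I_d − V Vᵀ)^{2p} A)`. -/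
theorem ommp_neumann_reformulation (d k p : ℕ) (hp : 1 ≤ p)
    (A : Matrix (Fin d) (Fin d) ℝ) (V : Matrix (Fin d) (Fin k) ℝ) :
    ((∑ i ∈ Finset.range (2 * p), (1 - Vᵀ * V) ^ i) * (Vᵀ * A * V)).trace
      = A.trace - (((1 - V * Vᵀ) ^ (2 * p)) * A).trace := by
  rw [← Matrix.mul_assoc, Matrix.trace_mul_comm, ← Matrix.mul_assoc, ← Matrix.mul_assoc,
    Matrix.mul_geom_sum_one_sub_mul, Matrix.sub_mul, Matrix.one_mul, Matrix.trace_sub]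
end

section
/- For every matrix A ∈ ℝ^{d×d}, every V ∈ ℝ^{d×k}, and every integer p ≥ 1, the identity tr((I_d − V Vᵀ)^{2p} A) − tr(A) = tr( ( Σ_{j=1}^{2p} (−1)^j · C(2p, j) · (Vᵀ V)^{j−1} ) · Vᵀ A V ) holds, where C(2p, j) is the binomial coefficient (2p choose j). -/
open Matrix

theorem Matrix.mul_pow_succ_eq {m n R : Type*} [Fintype m] [Fintype n] [DecidableEq m]
    [DecidableEq n] [Semiring R] (V : Matrix m n R) (W : Matrix n m R) (j : ℕ) :
    (V * W) ^ (j + 1) = V * (W * V) ^ j * W := by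
  induction j with
  | zero => simp
  | succ j ih => rw [pow_succ, ih, pow_succ]; simp only [Matrix.mul_assoc]

theorem Matrix.trace_mul_pow_succ_mul {m n R : Type*} [Fintype m] [Fintype n] [DecidableEq m]
    [DecidableEq n] [CommSemiring R] (V : Matrix m n R) (W : Matrix n m R) (A : Matrix m m R)
    (j : ℕ) : ((V * W) ^ (j + 1) * A).trace = ((W * V) ^ j * (W * A * V)).trace := by
  rw [Matrix.mul_pow_succ_eq, Matrix.mul_assoc, Matrix.mul_assoc, Matrix.trace_mul_comm]
  simp only [Matrix.mul_assoc]

theorem one_sub_pow_eq_sum_smul {R S : Type*} [CommRing R] [Ring S] [Algebra R S] (x : S) (n : ℕ) :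
    (1 - x) ^ n = ∑ j ∈ Finset.range (n + 1), ((-1 : R) ^ j * (n.choose j : R)) • x ^ j := by
  rw [sub_eq_neg_add, (Commute.one_right (-x)).add_pow]
  refine Finset.sum_congr rfl fun j _ => ?_
  rw [one_pow, mul_one, neg_pow, Algebra.smul_def, map_mul, map_pow, map_neg, map_one,
    map_natCast, mul_assoc, mul_assoc, (Nat.cast_commute (n.choose j) (x ^ j)).eq]

/-- The projector form of the OMM-p objective, `tr((I_d − V Vᵀ)^{2p} A) − tr(A)`,
equals the binomial-expanded form
`tr( ( Σ_{j=1}^{2p} (−1)^j C(2p,j) (VᵀV)^{j−1} ) Vᵀ A V )`. -/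
theorem ommp_binomial_expansion (d k p : ℕ) (hp : 1 ≤ p)
    (A : Matrix (Fin d) (Fin d) ℝ) (V : Matrix (Fin d) (Fin k) ℝ) :
    (((1 - V * Vᵀ) ^ (2 * p)) * A).trace - A.trace
      = ((∑ j ∈ Finset.Icc 1 (2 * p),
            ((-1 : ℝ) ^ j * ((2 * p).choose j : ℝ)) • (Vᵀ * V) ^ (j - 1))
          * (Vᵀ * A * V)).trace := by
  rw [one_sub_pow_eq_sum_smul (R := ℝ), Finset.sum_range_succ']
  have h_index : Finset.Icc 1 (2 * p) = Finset.Ico 1 (2 * p + 1) := by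
    ext j
    simp only [Finset.mem_Icc, Finset.mem_Ico]
    omega
  rw [h_index, Finset.sum_Ico_eq_sum_range]
  simp only [Matrix.add_mul, Finset.sum_mul, Matrix.smul_mul, Matrix.trace_add, Matrix.trace_sum,
    Matrix.trace_smul, Matrix.trace_mul_pow_succ_mul]
  simp [add_comm 1]
end

section
/- Let A ∈ ℝ^{d×d} be a symmetric positive semidefinite matrix with eigenvalues λ_1 ≥ λ_2 ≥ … ≥ λ_d ≥ 0 (listed with multiplicity), let k ≤ d, and let p ≥ 1 be an integer. Then for every matrix V ∈ ℝ^{d×k}, tr((I_d − V Vᵀ)^{2p} A) ≥ Σ_{i=k+1}^{d} λ_i; equivalently, the OMM-p objective satisfies L_p(V) := tr((I_d − V Vᵀ)^{2p} A) − tr(A) ≥ −Σ_{i=1}^{k} λ_i. -/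
open Matrix

/-- If weights `c i ∈ [0, 1]` have total mass at least `d - k`, the weighted sum of a nonnegative
antitone sequence dominates the sum of its `d - k` smallest terms. -/
lemma sum_tail_le_weighted_sum {d k : ℕ} (hk : k ≤ d) {μ c : Fin d → ℝ} (hμ : Antitone μ)
    (hμ0 : ∀ i, 0 ≤ μ i) (hc0 : ∀ i, 0 ≤ c i) (hc1 : ∀ i, c i ≤ 1)
    (hc : (d : ℝ) - k ≤ ∑ i, c i) :
    ∑ i ∈ Finset.univ.filter (fun i : Fin d => k ≤ (i : ℕ)), μ i ≤ ∑ i, c i * μ i := by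
  obtain ⟨t, ht0, hlt, hge⟩ : ∃ t : ℝ, 0 ≤ t ∧ (∀ i : Fin d, (i : ℕ) < k → t ≤ μ i) ∧
      ∀ i : Fin d, k ≤ (i : ℕ) → μ i ≤ t := by
    rcases hk.lt_or_eq with h | h
    · exact ⟨μ ⟨k, h⟩, hμ0 _, fun i hi => hμ (Fin.mk_le_mk.2 hi.le),
        fun i hi => hμ (Fin.mk_le_mk.2 hi)⟩
    · exact ⟨0, le_rfl, fun i _ => hμ0 i, fun i hi => by omega⟩
  have hcard : ∑ i : Fin d, (if k ≤ (i : ℕ) then (1 : ℝ) else 0) = d - k := by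
    rw [Fin.sum_univ_eq_sum_range (fun i => if k ≤ i then (1 : ℝ) else 0) d,
      ← Finset.sum_range_add_sum_Ico _ hk,
      Finset.sum_eq_zero fun i hi => if_neg (not_le.2 (Finset.mem_range.1 hi)),
      Finset.sum_congr rfl fun i hi => if_pos (Finset.mem_Ico.1 hi).1]
    simp [Nat.cast_sub hk]
  have hterm : ∀ i : Fin d, (c i - if k ≤ (i : ℕ) then 1 else 0) * t ≤
      (c i - if k ≤ (i : ℕ) then 1 else 0) * μ i := by
    intro i
    split_ifs with h
    · exact mul_le_mul_of_nonpos_left (hge i h) (by linarith [hc1 i])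
    · exact mul_le_mul_of_nonneg_left (hlt i (not_le.1 h)) (by linarith [hc0 i])
  have hsum := Finset.sum_le_sum fun i (_ : i ∈ Finset.univ) => hterm i
  rw [← Finset.sum_mul, Finset.sum_sub_distrib, hcard] at hsum
  simp only [sub_mul, Finset.sum_sub_distrib, ite_mul, one_mul, zero_mul] at hsum
  rw [← Finset.sum_filter] at hsum
  nlinarith [mul_nonneg (sub_nonneg.2 hc) ht0]

/-- `V * Vᵀ` is orthogonally diagonalizable with at most `k` nonzero eigenvalues. -/
lemma exists_orthogonal_diagonalization_mul_transpose {d k : ℕ} (V : Matrix (Fin d) (Fin k) ℝ) :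
    ∃ (U : Matrix (Fin d) (Fin d) ℝ) (s : Fin d → ℝ), Uᵀ * U = 1 ∧
      V * Vᵀ = U * diagonal s * Uᵀ ∧ (Finset.univ.filter fun j => s j ≠ 0).card ≤ k := by
  have hM : (V * Vᵀ).IsHermitian := by
    simpa using isHermitian_mul_conjTranspose_self V
  refine ⟨hM.eigenvectorUnitary, hM.eigenvalues, ?_, ?_, ?_⟩
  · simpa [star_eq_conjTranspose] using Unitary.coe_star_mul_self hM.eigenvectorUnitary
  · have h := hM.spectral_theorem
    rw [Unitary.conjStarAlgAut_apply] at h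
    simpa [star_eq_conjTranspose, Function.comp_def] using h
  · rw [← Fintype.card_subtype, ← hM.rank_eq_card_non_zero_eigs]
    exact (rank_mul_le_left _ _).trans V.rank_le_width

/-- Powers of `1 - U * diagonal s * Uᵀ` for orthogonal `U` are diagonal in the same basis. -/
lemma one_sub_conj_diagonal_pow {n : Type*} [Fintype n] [DecidableEq n] {U : Matrix n n ℝ}
    (hU : Uᵀ * U = 1) (s : n → ℝ) (m : ℕ) :
    (1 - U * diagonal s * Uᵀ) ^ m = U * diagonal (fun j => (1 - s j) ^ m) * Uᵀ := by
  have hU' : U * Uᵀ = 1 := mul_eq_one_comm.1 hU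
  induction m with
  | zero => simp [hU']
  | succ m ih =>
    have h : 1 - U * diagonal s * Uᵀ = U * diagonal (fun j => 1 - s j) * Uᵀ := by
      rw [← diagonal_sub, diagonal_one, Matrix.mul_sub, Matrix.sub_mul, Matrix.mul_one, hU']
    rw [pow_succ, ih, h]
    calc _ = U * diagonal (fun j => (1 - s j) ^ m) * (Uᵀ * U) * diagonal (fun j => 1 - s j) * Uᵀ := by
          simp only [Matrix.mul_assoc]
      _ = _ := by
          rw [hU, Matrix.mul_one, Matrix.mul_assoc U, diagonal_mul_diagonal]
          simp only [pow_succ]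

/-- The columns of an orthogonal matrix have unit norm. -/
lemma sum_col_sq_eq_one {n : Type*} [Fintype n] [DecidableEq n] {Q : Matrix n n ℝ}
    (hQ : Qᵀ * Q = 1) (j : n) : ∑ i, Q i j ^ 2 = 1 := by
  simpa [mul_apply, sq] using congrFun₂ hQ j j

/-- Lower bound for the OMM-p objective: if `A` is symmetric PSD with eigenvalues
`μ 0 ≥ μ 1 ≥ … ≥ μ (d−1) ≥ 0` (with multiplicity, encoded by an orthogonal
eigenbasis matrix `W` satisfying `Wᵀ W = I` and `A W = W diag(μ)`), `k ≤ d`, and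
`p ≥ 1`, then for every `V ∈ ℝ^{d×k}`,
`tr((I_d − V Vᵀ)^{2p} A) ≥ Σ_{i ≥ k} μ i`, i.e. the OMM-p objective
`L_p(V) = tr((I_d − V Vᵀ)^{2p} A) − tr(A)` is at least `−Σ_{i < k} μ i`. -/
theorem ommp_lower_bound (d k p : ℕ) (hk : k ≤ d) (hp : 1 ≤ p)
    (A : Matrix (Fin d) (Fin d) ℝ) (hA : A.PosSemidef)
    (μ : Fin d → ℝ) (hμ : Antitone μ) (hμ0 : ∀ i, 0 ≤ μ i)
    (W : Matrix (Fin d) (Fin d) ℝ) (hW : Wᵀ * W = 1)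
    (hAW : A * W = W * Matrix.diagonal μ)
    (V : Matrix (Fin d) (Fin k) ℝ) :
    ∑ i ∈ Finset.univ.filter (fun i : Fin d => k ≤ (i : ℕ)), μ i
      ≤ (((1 - V * Vᵀ) ^ (2 * p)) * A).trace := by
  obtain ⟨U, s, hU, hV, hs⟩ := exists_orthogonal_diagonalization_mul_transpose V
  have hW' : W * Wᵀ = 1 := mul_eq_one_comm.1 hW
  have hA' : A = W * diagonal μ * Wᵀ := by
    rw [← hAW, Matrix.mul_assoc, hW', Matrix.mul_one]
  set Q := Wᵀ * U with hQdef
  have hQ : Qᵀ * Q = 1 := by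
    rw [hQdef, transpose_mul, transpose_transpose, Matrix.mul_assoc, ← Matrix.mul_assoc W, hW',
      Matrix.one_mul, hU]
  have hQ' : Qᵀᵀ * Qᵀ = 1 := by rw [transpose_transpose]; exact mul_eq_one_comm.1 hQ
  have htrace : ((1 - V * Vᵀ) ^ (2 * p) * A).trace =
      ∑ j, (1 - s j) ^ (2 * p) * ∑ i, Q i j ^ 2 * μ i := by
    rw [hV, one_sub_conj_diagonal_pow hU, hA']
    calc _ = (U * (diagonal (fun j => (1 - s j) ^ (2 * p)) * (Uᵀ * W * diagonal μ * Wᵀ))).trace := by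
          simp only [Matrix.mul_assoc]
      _ = (diagonal (fun j => (1 - s j) ^ (2 * p)) * (Qᵀ * diagonal μ * Q)).trace := by
          rw [trace_mul_comm, hQdef, transpose_mul, transpose_transpose]
          simp only [Matrix.mul_assoc]
      _ = _ := by
          rw [trace]
          refine Finset.sum_congr rfl fun j _ => ?_
          rw [diag_apply, diagonal_mul, mul_apply]
          congr 1
          refine Finset.sum_congr rfl fun i _ => ?_
          rw [mul_diagonal, transpose_apply]
          ring
  set S := Finset.univ.filter fun j => s j = 0
  have hcard : (d : ℝ) - k ≤ S.card := by
    have h := Finset.card_filter_add_card_filter_not (s := Finset.univ) (fun j => s j = 0)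
    rw [Finset.card_univ, Fintype.card_fin] at h
    have : d ≤ S.card + k := h.symm.le.trans (Nat.add_le_add_left hs _)
    rw [sub_le_iff_le_add]
    exact_mod_cast this
  calc _ ≤ ∑ i, (∑ j ∈ S, Q i j ^ 2) * μ i := by
        refine sum_tail_le_weighted_sum hk hμ hμ0 (fun i => Finset.sum_nonneg fun j _ => sq_nonneg _)
          (fun i => ?_) ?_
        · rw [← sum_col_sq_eq_one hQ' i]
          exact Finset.sum_le_sum_of_subset_of_nonneg (Finset.subset_univ _)
            fun j _ _ => sq_nonneg _
        · rw [Finset.sum_comm, Finset.sum_congr rfl fun j _ => sum_col_sq_eq_one hQ j]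
          simpa using hcard
    _ = ∑ j ∈ S, (1 - s j) ^ (2 * p) * ∑ i, Q i j ^ 2 * μ i := by
        simp only [Finset.sum_mul]
        rw [Finset.sum_comm]
        refine Finset.sum_congr rfl fun j hj => ?_
        rw [(Finset.mem_filter.1 hj).2, sub_zero, one_pow, one_mul]
    _ ≤ ∑ j, (1 - s j) ^ (2 * p) * ∑ i, Q i j ^ 2 * μ i :=
        Finset.sum_le_sum_of_subset_of_nonneg (Finset.subset_univ _) fun j _ _ =>
          mul_nonneg ((even_two_mul p).pow_nonneg _)
            (Finset.sum_nonneg fun i _ => mul_nonneg (sq_nonneg _) (hμ0 i))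
    _ = _ := htrace.symm
end

section
/- Let A ∈ ℝ^{d×d} be a symmetric positive semidefinite matrix with eigenvalues λ_1 ≥ … ≥ λ_d ≥ 0 and a corresponding orthonormal family of eigenvectors w_1, …, w_d, let 1 ≤ k < d, and assume the top k+1 eigenvalues are all distinct: λ_1 > λ_2 > … > λ_k > λ_{k+1}. Let p ≥ 1 be an integer and let α_1, …, α_k > 0 be positive weights. If V* ∈ ℝ^{d×k}, with columns v*_1, …, v*_k, is a global minimizer over ℝ^{d×k} of the jointly nested objective J(V) := Σ_{i=1}^{k} α_i · ( tr((I_d − V_{1:i} V_{1:i}ᵀ)^{2p} A) − tr(A) ), where V_{1:i} ∈ ℝ^{d×i} consists of the first i columns of V, then for every i ∈ {1, …, k}, v*_i (v*_i)ᵀ = w_i w_iᵀ (i.e., v*_i = ± w_i). -/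
open Matrix

/-- The number of indices of `Fin d` that are at least `m`, as a real sum. -/
lemma sum_ite_lt_zero_one {d m : ℕ} (hm : m ≤ d) :
    ∑ j : Fin d, (if (j : ℕ) < m then (0 : ℝ) else 1) = d - m := by
  obtain ⟨n, rfl⟩ := Nat.exists_eq_add_of_le hm
  rw [Fin.sum_univ_add]
  simp

/-- Weights `s` dominating fractional weights `q ∈ [0, 1]` of total mass at least `d - m` give an
antitone sequence at least the sum of its last `d - m` terms; equality determines the weights. -/
lemma sum_tail_le_weighted_sum_s9 {d m : ℕ} (hm : m < d) (μ q s : Fin d → ℝ) (hμ : Antitone μ)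
    (hμ0 : ∀ j, 0 ≤ μ j) (hq0 : ∀ j, 0 ≤ q j) (hq1 : ∀ j, q j ≤ 1) (hqs : ∀ j, q j ≤ s j)
    (hq : (d : ℝ) - m ≤ ∑ j, q j) :
    (∑ j : Fin d, (if (j : ℕ) < m then 0 else μ j) ≤ ∑ j, s j * μ j) ∧
    ((∀ j : Fin d, (j : ℕ) < m → μ ⟨m, hm⟩ < μ j) →
      ∑ j, s j * μ j = ∑ j : Fin d, (if (j : ℕ) < m then 0 else μ j) →
      ∀ j : Fin d, ((j : ℕ) < m → s j = 0) ∧ (m ≤ (j : ℕ) → q j = 1)) := by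
  set c := μ ⟨m, hm⟩ with hc
  have hc0 : 0 ≤ c := hμ0 _
  let e : Fin d → ℝ := fun j => if (j : ℕ) < m then 0 else 1
  let t : Fin d → ℝ := fun j =>
    s j * μ j - (if (j : ℕ) < m then 0 else μ j) - c * (q j - e j)
  have hlo : ∀ j : Fin d, (j : ℕ) < m → c ≤ μ j := fun j hj => hμ (Fin.le_def.2 hj.le)
  have hhi : ∀ j : Fin d, m ≤ (j : ℕ) → μ j ≤ c := fun j hj => hμ (Fin.le_def.2 hj)
  have ht : ∀ j, 0 ≤ t j := by
    intro j
    have h1 := mul_nonneg (sub_nonneg.2 (hqs j)) (hμ0 j)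
    by_cases hj : (j : ℕ) < m
    · have h2 := mul_nonneg (hq0 j) (sub_nonneg.2 (hlo j hj))
      simp only [t, e, if_pos hj]
      nlinarith
    · have h2 := mul_nonneg (sub_nonneg.2 (hq1 j)) (sub_nonneg.2 (hhi j (not_lt.1 hj)))
      simp only [t, e, if_neg hj]
      nlinarith
  have hsum : ∑ j, t j = ∑ j, s j * μ j - ∑ j : Fin d, (if (j : ℕ) < m then 0 else μ j)
      - c * (∑ j, q j - (d - m)) := by
    rw [← sum_ite_lt_zero_one hm.le]
    simp only [t, e, Finset.sum_sub_distrib, ← Finset.mul_sum]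
  have hmass := mul_nonneg hc0 (sub_nonneg.2 hq)
  have htsum : 0 ≤ ∑ j, t j := Finset.sum_nonneg fun j _ => ht j
  refine ⟨by linarith, fun hgap heq => ?_⟩
  have ht0 : ∀ j, t j = 0 := fun j =>
    (Finset.sum_eq_zero_iff_of_nonneg fun j _ => ht j).1 (by linarith) j (Finset.mem_univ j)
  have hq_zero : ∀ j : Fin d, (j : ℕ) < m → q j = 0 ∧ s j = 0 := by
    intro j hj
    have h := ht0 j
    have h1 := mul_nonneg (sub_nonneg.2 (hqs j)) (hμ0 j)
    have hg := hgap j hj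
    have h2 := mul_nonneg (hq0 j) (sub_nonneg.2 hg.le)
    simp only [t, e, if_pos hj] at h
    have h3 : q j * (μ j - c) = 0 := by nlinarith
    have hqz : q j = 0 := (mul_eq_zero.1 h3).resolve_right (sub_pos.2 hg).ne'
    have h4 : s j * μ j = 0 := by simpa [hqz] using h
    exact ⟨hqz, (mul_eq_zero.1 h4).resolve_right (hc0.trans_lt hg).ne'⟩
  have hqe : ∀ j, 0 ≤ e j - q j := by
    intro j
    by_cases hj : (j : ℕ) < m
    · simp [e, hj, (hq_zero j hj).1]
    · simpa [e, hj] using hq1 j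
  have hqe_sum : ∑ j, (e j - q j) = 0 := by
    refine le_antisymm ?_ (Finset.sum_nonneg fun j _ => hqe j)
    rw [Finset.sum_sub_distrib, sum_ite_lt_zero_one hm.le]
    linarith
  refine fun j => ⟨fun hj => (hq_zero j hj).2, fun hj => ?_⟩
  have h := (Finset.sum_eq_zero_iff_of_nonneg fun j _ => hqe j).1 hqe_sum j (Finset.mem_univ j)
  simp only [e, if_neg (not_lt.2 hj)] at h
  linarith

/-- Spectral theorem for real symmetric matrices, with an explicit orthogonal matrix. -/
lemma exists_orthogonal_diagonalization {n : Type*} [Fintype n] [DecidableEq n]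
    {N : Matrix n n ℝ} (hN : N.IsHermitian) :
    ∃ (Z : Matrix n n ℝ) (ν : n → ℝ), Zᵀ * Z = 1 ∧ Z * Zᵀ = 1 ∧ N = Z * diagonal ν * Zᵀ := by
  refine ⟨hN.eigenvectorUnitary, hN.eigenvalues, ?_, ?_, ?_⟩
  · simpa [star_eq_conjTranspose] using Unitary.coe_star_mul_self hN.eigenvectorUnitary
  · simpa [star_eq_conjTranspose] using Unitary.coe_mul_star_self hN.eigenvectorUnitary
  · conv_lhs => rw [hN.spectral_theorem]
    simp [Unitary.conjStarAlgAut_apply, star_eq_conjTranspose]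

lemma orthogonal_conj_pow {n : Type*} [Fintype n] [DecidableEq n] {Z : Matrix n n ℝ}
    (hZ : Zᵀ * Z = 1) (D : Matrix n n ℝ) (r : ℕ) :
    (Z * D * Zᵀ) ^ r = Z * D ^ r * Zᵀ := by
  induction r with
  | zero => simp [mul_eq_one_comm.1 hZ]
  | succ r ih =>
    rw [pow_succ, ih, pow_succ]
    calc Z * D ^ r * Zᵀ * (Z * D * Zᵀ) = Z * D ^ r * (Zᵀ * Z) * D * Zᵀ := by
          simp only [Matrix.mul_assoc]
      _ = _ := by rw [hZ]; simp only [Matrix.mul_assoc, Matrix.one_mul]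

lemma conj_diagonal_apply {n : Type*} [Fintype n] [DecidableEq n] (Z : Matrix n n ℝ)
    (ν : n → ℝ) (i j : n) : (Z * diagonal ν * Zᵀ) i j = ∑ a, ν a * (Z i a * Z j a) := by
  simp only [mul_apply (M := Z * diagonal ν), mul_diagonal, transpose_apply]
  exact Finset.sum_congr rfl fun a _ => by ring

/-- At least `d - m` eigenvalues of `1 - U Uᵀ` equal `1` when `U` has `m` columns. -/
lemma le_card_eigenvalue_one {d m : ℕ} (U : Matrix (Fin d) (Fin m) ℝ)
    {Z : Matrix (Fin d) (Fin d) ℝ} {ν : Fin d → ℝ} (hZ : Zᵀ * Z = 1)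
    (hN : 1 - U * Uᵀ = Z * diagonal ν * Zᵀ) :
    (d : ℝ) - m ≤ ∑ a, if ν a = 1 then (1 : ℝ) else 0 := by
  have hdiag : diagonal (fun a => 1 - ν a) = (Zᵀ * U) * (Uᵀ * Z) := by
    have h1 : U * Uᵀ = 1 - Z * diagonal ν * Zᵀ := by rw [← hN]; abel
    calc diagonal (fun a => 1 - ν a) = 1 - diagonal ν := by
          rw [← diagonal_one, diagonal_sub]
      _ = Zᵀ * Z - (Zᵀ * Z) * diagonal ν * (Zᵀ * Z) := by simp [hZ]
      _ = Zᵀ * (1 - Z * diagonal ν * Zᵀ) * Z := by noncomm_ring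
      _ = _ := by rw [← h1]; simp only [Matrix.mul_assoc]
  have hrank : Fintype.card {a // 1 - ν a ≠ 0} ≤ m := by
    rw [← rank_diagonal, hdiag]
    exact (rank_mul_le_left _ _).trans ((rank_le_card_width _).trans (by simp))
  have hsplit : ∑ a, (if ν a = 1 then (1 : ℝ) else 0) + Fintype.card {a // 1 - ν a ≠ 0} = d := by
    rw [Fintype.card_subtype, Finset.card_filter]
    push_cast
    rw [← Finset.sum_add_distrib]
    have : ∀ a, ((if ν a = 1 then (1 : ℝ) else 0) + if 1 - ν a ≠ 0 then 1 else 0) = 1 := by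
      intro a
      by_cases h : ν a = 1
      · simp [h]
      · simp [h, sub_eq_zero, Ne.symm h]
    simp only [this]
    simp
  have : (Fintype.card {a // 1 - ν a ≠ 0} : ℝ) ≤ m := by exact_mod_cast hrank
  linarith

/-- Lower bound and equality case for the OMM-p objective of a diagonal matrix. -/
lemma trace_pow_mul_diagonal {d m p : ℕ} (hm : m < d) (hp : 1 ≤ p) (μ : Fin d → ℝ)
    (hμ : Antitone μ) (hμ0 : ∀ j, 0 ≤ μ j) (U : Matrix (Fin d) (Fin m) ℝ) :
    (∑ j : Fin d, (if (j : ℕ) < m then 0 else μ j) ≤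
      ((1 - U * Uᵀ) ^ (2 * p) * diagonal μ).trace) ∧
    ((∀ j : Fin d, (j : ℕ) < m → μ ⟨m, hm⟩ < μ j) →
      ((1 - U * Uᵀ) ^ (2 * p) * diagonal μ).trace =
        ∑ j : Fin d, (if (j : ℕ) < m then 0 else μ j) →
      U * Uᵀ = diagonal fun j : Fin d => if (j : ℕ) < m then 1 else 0) := by
  have hherm : (1 - U * Uᵀ).IsHermitian := by
    simp [Matrix.IsHermitian, conjTranspose_eq_transpose_of_trivial]
  obtain ⟨Z, ν, hZ, hZ', hN⟩ := exists_orthogonal_diagonalization hherm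
  have hrow : ∀ j, ∑ a, Z j a * Z j a = 1 := by
    intro j
    simpa [mul_apply] using congrFun (congrFun hZ' j) j
  have hcol : ∀ a, ∑ j, Z j a * Z j a = 1 := by
    intro a
    simpa [mul_apply] using congrFun (congrFun hZ a) a
  let q : Fin d → ℝ := fun j => ∑ a, (if ν a = 1 then 1 else 0) * (Z j a * Z j a)
  let s : Fin d → ℝ := fun j => ∑ a, ν a ^ (2 * p) * (Z j a * Z j a)
  have htrace : ((1 - U * Uᵀ) ^ (2 * p) * diagonal μ).trace = ∑ j, s j * μ j := by
    rw [hN, orthogonal_conj_pow hZ, diagonal_pow]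
    simp only [trace, diag_apply, mul_diagonal, conj_diagonal_apply, Pi.pow_apply, s]
  have hpow : ∀ a, 0 ≤ ν a ^ (2 * p) := fun a => (even_two_mul p).pow_nonneg _
  have hq0 : ∀ j, 0 ≤ q j := fun j => Finset.sum_nonneg fun a _ =>
    mul_nonneg (by split_ifs <;> norm_num) (mul_self_nonneg _)
  have hq1 : ∀ j, q j ≤ 1 := fun j => (hrow j).subst <| Finset.sum_le_sum fun a _ =>
    mul_le_of_le_one_left (mul_self_nonneg _) (by split_ifs <;> norm_num)
  have hqs : ∀ j, q j ≤ s j := fun j => Finset.sum_le_sum fun a _ =>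
    mul_le_mul_of_nonneg_right (by split_ifs with h <;> simp [h, hpow]) (mul_self_nonneg _)
  have hq : (d : ℝ) - m ≤ ∑ j, q j := by
    refine (le_card_eigenvalue_one U hZ hN).trans_eq ?_
    simp only [q]
    rw [Finset.sum_comm]
    simp only [← Finset.mul_sum, hcol, mul_one]
  obtain ⟨hle, hcase⟩ := sum_tail_le_weighted_sum_s9 hm μ q s hμ hμ0 hq0 hq1 hqs hq
  rw [htrace]
  refine ⟨hle, fun hgap heq => ?_⟩
  have key := hcase hgap heq
  have hentry : ∀ (j : Fin d) (a : Fin d),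
      ν a * Z j a = (if (j : ℕ) < m then 0 else 1) * Z j a := by
    intro j a
    by_cases hj : (j : ℕ) < m
    · have h := (Finset.sum_eq_zero_iff_of_nonneg fun a _ =>
        mul_nonneg (hpow a) (mul_self_nonneg (Z j a))).1 ((key j).1 hj) a (Finset.mem_univ a)
      rcases mul_eq_zero.1 h with h | h
      · simp [hj, pow_eq_zero_iff (by omega : 2 * p ≠ 0) |>.1 h]
      · simp [mul_self_eq_zero.1 h]
    · have h1 : ∑ a, (1 - if ν a = 1 then (1 : ℝ) else 0) * (Z j a * Z j a) = 0 := by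
        have := (key j).2 (not_lt.1 hj)
        simp only [sub_mul, one_mul, Finset.sum_sub_distrib, hrow]
        simp only [q] at this
        rw [this, sub_self]
      have h := (Finset.sum_eq_zero_iff_of_nonneg fun a _ => mul_nonneg
        (by split_ifs <;> norm_num) (mul_self_nonneg (Z j a))).1 h1 a (Finset.mem_univ a)
      by_cases hν : ν a = 1
      · simp [hj, hν]
      · have : Z j a = 0 := by simpa [hν] using h
        simp [this]
  have hNd : 1 - U * Uᵀ = diagonal fun j : Fin d => if (j : ℕ) < m then 0 else 1 := by
    rw [hN]
    ext i j
    rw [conj_diagonal_apply]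
    calc ∑ a, ν a * (Z i a * Z j a)
        = (if (i : ℕ) < m then 0 else 1) * ∑ a, Z i a * Z j a := by
          rw [Finset.mul_sum]
          exact Finset.sum_congr rfl fun a _ => by rw [← mul_assoc, hentry, mul_assoc]
      _ = (if (i : ℕ) < m then 0 else 1) * (1 : Matrix (Fin d) (Fin d) ℝ) i j := by
          rw [← hZ', mul_apply]; rfl
      _ = _ := by
          by_cases h : i = j
          · subst h; simp
          · simp [h]
  calc U * Uᵀ = 1 - (1 - U * Uᵀ) := by abel
    _ = _ := by
      rw [hNd, ← diagonal_one, diagonal_sub]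
      congr 1
      ext j
      split_ifs <;> simp

lemma submatrix_castLE_mul_transpose {d m : ℕ} (hm : m ≤ d) (W : Matrix (Fin d) (Fin d) ℝ) :
    W.submatrix id (Fin.castLE hm) * (W.submatrix id (Fin.castLE hm))ᵀ =
      W * (diagonal fun j : Fin d => if (j : ℕ) < m then 1 else 0) * Wᵀ := by
  obtain ⟨n, rfl⟩ := Nat.exists_eq_add_of_le hm
  ext a b
  rw [conj_diagonal_apply, Fin.sum_univ_add]
  simp [mul_apply]
  rfl

/-- Lower bound for the OMM-p objective, its attainment at the leading eigenvectors, and the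
equality case. -/
lemma trace_pow_mul_eigen {d m p : ℕ} (hm : m < d) (hp : 1 ≤ p)
    (A : Matrix (Fin d) (Fin d) ℝ) (μ : Fin d → ℝ) (hμ : Antitone μ) (hμ0 : ∀ j, 0 ≤ μ j)
    (W : Matrix (Fin d) (Fin d) ℝ) (hW : Wᵀ * W = 1) (hAW : A * W = W * diagonal μ)
    (Wm : Matrix (Fin d) (Fin m) ℝ) (hWm : Wm = W.submatrix id (Fin.castLE hm.le))
    (U : Matrix (Fin d) (Fin m) ℝ) :
    ((1 - Wm * Wmᵀ) ^ (2 * p) * A).trace ≤ ((1 - U * Uᵀ) ^ (2 * p) * A).trace ∧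
    ((∀ j : Fin d, (j : ℕ) < m → μ ⟨m, hm⟩ < μ j) →
      ((1 - U * Uᵀ) ^ (2 * p) * A).trace = ((1 - Wm * Wmᵀ) ^ (2 * p) * A).trace →
      U * Uᵀ = Wm * Wmᵀ) := by
  have hW' : W * Wᵀ = 1 := mul_eq_one_comm.1 hW
  have hA : A = W * diagonal μ * Wᵀ := by rw [← hAW, Matrix.mul_assoc, hW', Matrix.mul_one]
  have hconj : ∀ N : Matrix (Fin d) (Fin d) ℝ,
      ((W * N * Wᵀ) ^ (2 * p) * A).trace = (N ^ (2 * p) * diagonal μ).trace := by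
    intro N
    rw [orthogonal_conj_pow hW, hA]
    calc (W * N ^ (2 * p) * Wᵀ * (W * diagonal μ * Wᵀ)).trace
        = (W * (N ^ (2 * p) * (Wᵀ * W) * diagonal μ * Wᵀ)).trace := by
          simp only [Matrix.mul_assoc]
      _ = (N ^ (2 * p) * diagonal μ * (Wᵀ * W)).trace := by
          rw [trace_mul_comm, hW, Matrix.mul_one, Matrix.mul_assoc, hW]
      _ = _ := by rw [hW, Matrix.mul_one]
  have hUW : U * Uᵀ = W * ((Wᵀ * U) * (Wᵀ * U)ᵀ) * Wᵀ := by
    calc U * Uᵀ = (W * Wᵀ) * U * Uᵀ * (W * Wᵀ) := by simp [hW']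
      _ = _ := by simp only [transpose_mul, transpose_transpose, Matrix.mul_assoc]
  have hsub : ∀ N : Matrix (Fin d) (Fin d) ℝ, 1 - W * N * Wᵀ = W * (1 - N) * Wᵀ := by
    intro N
    rw [Matrix.mul_sub, Matrix.sub_mul, Matrix.mul_one, hW']
  have hWW : Wm * Wmᵀ = W * (diagonal fun j : Fin d => if (j : ℕ) < m then 1 else 0) * Wᵀ := by
    rw [hWm, submatrix_castLE_mul_transpose]
  have hval : ((1 - Wm * Wmᵀ) ^ (2 * p) * A).trace =
      ∑ j : Fin d, (if (j : ℕ) < m then 0 else μ j) := by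
    rw [hWW, hsub, hconj, ← diagonal_one, diagonal_sub, diagonal_pow, diagonal_mul_diagonal,
      trace_diagonal]
    refine Finset.sum_congr rfl fun j _ => ?_
    have hp0 : p ≠ 0 := by omega
    by_cases hj : (j : ℕ) < m <;> simp [hj, hp0]
  rw [hval, hWW, hUW, hsub, hconj]
  obtain ⟨h1, h2⟩ := trace_pow_mul_diagonal hm hp μ hμ hμ0 (Wᵀ * U)
  exact ⟨h1, fun hgap heq => by rw [h2 hgap heq]⟩

/-- Consistency of the jointly nested OMM-p objective: let `A` be symmetric PSD
with eigenvalues `μ 0 ≥ … ≥ μ (d−1) ≥ 0` and orthonormal eigenvectors given by the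
columns of `W`, `1 ≤ k < d`, with the top `k+1` eigenvalues all distinct; let
`p ≥ 1` and let `α i > 0` be positive weights. If `Vstar ∈ ℝ^{d×k}` is a global
minimizer of the jointly nested objective
`J(V) := Σ_{i=1}^{k} α_i (tr((I_d − V_{1:i} V_{1:i}ᵀ)^{2p} A) − tr(A))`,
then each column of `Vstar` satisfies `v*_i (v*_i)ᵀ = w_i w_iᵀ`. -/
theorem jointly_nested_ommp_minimizer (d k p : ℕ) (hk1 : 1 ≤ k) (hk : k < d) (hp : 1 ≤ p)
    (A : Matrix (Fin d) (Fin d) ℝ) (hA : A.PosSemidef)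
    (μ : Fin d → ℝ) (hμ : Antitone μ) (hμ0 : ∀ i, 0 ≤ μ i)
    (hdistinct : ∀ i j : Fin d, (i : ℕ) < (j : ℕ) → (j : ℕ) ≤ k → μ j < μ i)
    (W : Matrix (Fin d) (Fin d) ℝ) (hW : Wᵀ * W = 1)
    (hAW : A * W = W * Matrix.diagonal μ)
    (α : Fin k → ℝ) (hα : ∀ i, 0 < α i)
    (Vstar : Matrix (Fin d) (Fin k) ℝ)
    (hmin : ∀ V : Matrix (Fin d) (Fin k) ℝ,
      (∑ i : Fin k, α i *
        ((((1 - (Vstar.submatrix id (Fin.castLE i.isLt))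
              * (Vstar.submatrix id (Fin.castLE i.isLt))ᵀ) ^ (2 * p)) * A).trace
          - A.trace))
      ≤ ∑ i : Fin k, α i *
        ((((1 - (V.submatrix id (Fin.castLE i.isLt))
              * (V.submatrix id (Fin.castLE i.isLt))ᵀ) ^ (2 * p)) * A).trace
          - A.trace)) :
    ∀ i : Fin k,
      vecMulVec (fun a => Vstar a i) (fun a => Vstar a i)
        = vecMulVec (fun a => W a (Fin.castLE hk.le i)) (fun a => W a (Fin.castLE hk.le i)) := by
  have hlt : ∀ i : Fin k, (i : ℕ) + 1 < d := fun i => by omega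
  let Wk : Matrix (Fin d) (Fin k) ℝ := W.submatrix id (Fin.castLE hk.le)
  have hopt : ∀ i : Fin k, _ := fun i =>
    trace_pow_mul_eigen (hlt i) hp A μ hμ hμ0 W hW hAW
      (Wk.submatrix id (Fin.castLE i.isLt)) rfl (Vstar.submatrix id (Fin.castLE i.isLt))
  have hterm := fun i : Fin k =>
    mul_le_mul_of_nonneg_left (sub_le_sub_right (hopt i).1 A.trace) (hα i).le
  have hgram : ∀ i : Fin k,
      Vstar.submatrix id (Fin.castLE i.isLt) * (Vstar.submatrix id (Fin.castLE i.isLt))ᵀ =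
        Wk.submatrix id (Fin.castLE i.isLt) * (Wk.submatrix id (Fin.castLE i.isLt))ᵀ := by
    intro i
    refine (hopt i).2 (fun j hj => hdistinct j _ hj i.isLt) ?_
    have h := (Finset.sum_eq_sum_iff_of_le fun i _ => hterm i).1
      (le_antisymm (Finset.sum_le_sum fun i _ => hterm i) (hmin Wk)) i (Finset.mem_univ i)
    exact (sub_left_injective (mul_left_cancel₀ (hα i).ne' h)).symm
  have hsums : ∀ (n : ℕ) (hn : n ≤ k) (a b : Fin d),
      ∑ j : Fin n, Vstar a (Fin.castLE hn j) * Vstar b (Fin.castLE hn j) =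
        ∑ j : Fin n, Wk a (Fin.castLE hn j) * Wk b (Fin.castLE hn j) := by
    intro n hn a b
    cases n with
    | zero => simp
    | succ n => simpa [mul_apply] using congrFun (congrFun (hgram ⟨n, hn⟩) a) b
  intro i
  ext a b
  have h1 := hsums (i + 1) i.isLt a b
  rw [Fin.sum_univ_castSucc, Fin.sum_univ_castSucc] at h1
  exact add_left_cancel ((congrArg (· + _) (hsums i i.isLt.le a b)).symm.trans h1)
end

section
/- Let A ∈ ℝ^{d×d} be a symmetric matrix with a negative eigenvalue, i.e., there exist a unit vector w ∈ ℝ^d and λ < 0 with A w = λ w. Then the OMM-1 objective is unbounded below on ℝ^d: for every M ∈ ℝ there exists v ∈ ℝ^d such that tr((I_d − v vᵀ)² A) − tr(A) < M. -/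
open Matrix

/-- The square of `I - v vᵀ` is an affine function of `v vᵀ`. -/
theorem one_sub_vecMulVec_self_sq {n R : Type*} [Fintype n] [DecidableEq n] [CommRing R]
    (v : n → R) :
    (1 - vecMulVec v v) ^ 2 = 1 + (v ⬝ᵥ v - 2) • vecMulVec v v := by
  have h : vecMulVec v v * vecMulVec v v = (v ⬝ᵥ v) • vecMulVec v v := by
    rw [vecMulVec_mul_vecMulVec, vecMulVec_smul]
  rw [sq, sub_mul, one_mul, mul_sub, mul_one, h, sub_smul, two_smul]
  abel

/-- The rank-one OMM-1 objective equals `(vᵀ v - 2) (vᵀ A v)`. -/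
theorem trace_one_sub_vecMulVec_self_sq_mul_sub_trace {n R : Type*} [Fintype n] [DecidableEq n]
    [CommRing R] (A : Matrix n n R) (v : n → R) :
    ((1 - vecMulVec v v) ^ 2 * A).trace - A.trace = (v ⬝ᵥ v - 2) * (v ⬝ᵥ A *ᵥ v) := by
  rw [one_sub_vecMulVec_self_sq, add_mul, one_mul, smul_mul_assoc, trace_add, trace_smul,
    vecMulVec_mul, trace_vecMulVec, dotProduct_mulVec, dotProduct_comm v (v ᵥ* A), smul_eq_mul,
    add_sub_cancel_left]

/-- If a symmetric matrix `A` has a negative eigenvalue (a unit vector `w` with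
`A w = λ w`, `λ < 0`), then the rank-one OMM-1 objective
`L_1(v) := tr((I_d − v vᵀ)² A) − tr(A)` is unbounded below on `ℝ^d`. -/
theorem omm1_unbounded_below_of_neg_eigenvalue (d : ℕ)
    (A : Matrix (Fin d) (Fin d) ℝ) (hA : A.IsSymm)
    (w : Fin d → ℝ) (hw : ∑ i, (w i) ^ 2 = 1)
    (lam : ℝ) (hlam : lam < 0) (hAw : A *ᵥ w = lam • w) :
    ∀ M : ℝ, ∃ v : Fin d → ℝ,
      (((1 - vecMulVec v v) ^ 2) * A).trace - A.trace < M := by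
  intro M
  have hww : w ⬝ᵥ w = 1 := by simpa [dotProduct, sq] using hw
  obtain ⟨c, hc, hcM⟩ : ∃ c : ℝ, 0 ≤ c ∧ c * lam = -|M| :=
    ⟨|M| / -lam, div_nonneg (abs_nonneg M) (by linarith), by
      rw [div_neg, neg_mul, div_mul_cancel₀ _ hlam.ne]⟩
  refine ⟨(2 + c) • w, ?_⟩
  rw [trace_one_sub_vecMulVec_self_sq_mul_sub_trace]
  simp only [mulVec_smul, hAw, smul_dotProduct, dotProduct_smul, hww, smul_eq_mul, mul_one]
  have hbound : 1 + c ≤ ((2 + c) * (2 + c) - 2) * ((2 + c) * (2 + c)) := by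
    nlinarith [mul_nonneg hc hc, mul_nonneg (mul_nonneg hc hc) hc, sq_nonneg (c * c)]
  calc ((2 + c) * (2 + c) - 2) * ((2 + c) * (lam * (2 + c)))
      = ((2 + c) * (2 + c) - 2) * ((2 + c) * (2 + c)) * lam := by ring
    _ ≤ (1 + c) * lam := mul_le_mul_of_nonpos_right hbound hlam.le
    _ < M := by linarith [neg_abs_le M]
end

section
/- For every matrix A ∈ ℝ^{d×d}, every κ ∈ ℝ, and every V ∈ ℝ^{d×k}, the identity −tr((2·I_k − VᵀV)·Vᵀ(A + κ·I_d)V) = −tr((2·I_k − VᵀV)·Vᵀ A V) + κ·‖VᵀV − I_k‖_F² − κ·k holds; i.e., applying the OMM-1 objective to the spectrum-shifted matrix A + κ·I_d equals, up to the additive constant −κk, the OMM-1 objective for A plus the squared-Frobenius-norm orthonormality penalty κ·‖VᵀV − I_k‖_F². -/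
open Matrix

/-- Equivalence of spectrum shift and orthonormality regularization for OMM-1:
applying the OMM-1 objective to `A + κ I_d` equals the OMM-1 objective for `A`
plus the penalty `κ ‖VᵀV − I_k‖_F²`, minus the constant `κ k`. -/
theorem omm1_shift_eq_regularization (d k : ℕ)
    (A : Matrix (Fin d) (Fin d) ℝ) (κ : ℝ) (V : Matrix (Fin d) (Fin k) ℝ) :
    -(((2 : ℝ) • (1 : Matrix (Fin k) (Fin k) ℝ) - Vᵀ * V)
        * (Vᵀ * (A + κ • (1 : Matrix (Fin d) (Fin d) ℝ)) * V)).trace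
      = -(((2 : ℝ) • (1 : Matrix (Fin k) (Fin k) ℝ) - Vᵀ * V) * (Vᵀ * A * V)).trace
        + κ * ((Vᵀ * V - 1)ᵀ * (Vᵀ * V - 1)).trace
        - κ * k := by
  have h_shift : Vᵀ * (A + κ • (1 : Matrix (Fin d) (Fin d) ℝ)) * V
      = Vᵀ * A * V + κ • (Vᵀ * V) := by
    simp [Matrix.mul_add, Matrix.add_mul]
  have h_symm : (Vᵀ * V - 1)ᵀ = Vᵀ * V - 1 := by
    simp [Matrix.transpose_mul]
  rw [h_shift, h_symm]
  generalize Vᵀ * V = G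
  generalize Vᵀ * A * V = M
  simp only [Matrix.mul_add, Matrix.sub_mul, Matrix.mul_sub, Matrix.smul_mul, Matrix.mul_smul,
    Matrix.one_mul, Matrix.mul_one, Matrix.trace_add, Matrix.trace_sub, Matrix.trace_smul,
    Matrix.trace_one, Fintype.card_fin, smul_eq_mul]
  ring
end

section
/- Let A ∈ ℝ^{d×d} be a symmetric matrix and p ≥ 1 an integer. The function f : ℝ^{d×k} → ℝ defined by f(V) := tr((I_d − V Vᵀ)^{2p} A) is differentiable, and its gradient with respect to the Frobenius inner product at every V is ∇f(V) = −2·( Σ_{i=0}^{2p−1} R^i A R^{2p−1−i} )·V, where R := I_d − V Vᵀ; that is, the Fréchet derivative of f at V applied to H ∈ ℝ^{d×k} equals tr( (−2·( Σ_{i=0}^{2p−1} R^i A R^{2p−1−i} )·V)ᵀ H ). -/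
attribute [local instance] Matrix.normedAddCommGroup Matrix.normedSpace

open Matrix

section Calculus

variable {l m n E : Type*} [Fintype l] [Fintype m] [Fintype n]
  [NormedAddCommGroup E] [NormedSpace ℝ E]

theorem HasFDerivAt.matrix_mul {f : E → Matrix l m ℝ} {g : E → Matrix m n ℝ} {x : E}
    {f' : E →L[ℝ] Matrix l m ℝ} {g' : E →L[ℝ] Matrix m n ℝ}
    (hf : HasFDerivAt f f' x) (hg : HasFDerivAt g g' x) :
    ∃ D : E →L[ℝ] Matrix l n ℝ, HasFDerivAt (fun y => f y * g y) D x ∧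
      ∀ h, D h = f x * g' h + f' h * g x :=
  let B := (mulLinearMap ℝ : Matrix l m ℝ →ₗ[ℝ] Matrix m n ℝ →ₗ[ℝ] Matrix l n ℝ)
  ⟨_, B.toContinuousBilinearMap.hasFDerivAt_of_bilinear hf hg, fun _ => rfl⟩

theorem HasFDerivAt.matrix_transpose {f : E → Matrix m n ℝ} {x : E}
    {f' : E →L[ℝ] Matrix m n ℝ} (hf : HasFDerivAt f f' x) :
    ∃ D : E →L[ℝ] Matrix n m ℝ, HasFDerivAt (fun y => (f y)ᵀ) D x ∧ ∀ h, D h = (f' h)ᵀ :=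
  let T := (transposeLinearEquiv m n ℝ ℝ).toLinearMap.toContinuousLinearMap
  ⟨_, T.hasFDerivAt.comp x hf, fun _ => rfl⟩

theorem HasFDerivAt.matrix_trace {f : E → Matrix n n ℝ} {x : E}
    {f' : E →L[ℝ] Matrix n n ℝ} (hf : HasFDerivAt f f' x) :
    ∃ D : E →L[ℝ] ℝ, HasFDerivAt (fun y => (f y).trace) D x ∧ ∀ h, D h = (f' h).trace :=
  let T := (traceLinearMap n ℝ ℝ).toContinuousLinearMap
  ⟨_, T.hasFDerivAt.comp x hf, fun _ => rfl⟩

theorem HasFDerivAt.matrix_pow [DecidableEq n] {f : E → Matrix n n ℝ} {x : E}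
    {f' : E →L[ℝ] Matrix n n ℝ} (hf : HasFDerivAt f f' x) (N : ℕ) :
    ∃ D : E →L[ℝ] Matrix n n ℝ, HasFDerivAt (fun y => f y ^ N) D x ∧
      ∀ h, D h = ∑ i ∈ Finset.range N, f x ^ (N - 1 - i) * f' h * f x ^ i := by
  induction N with
  | zero => exact ⟨0, by simpa using hasFDerivAt_const (1 : Matrix n n ℝ) x, by simp⟩
  | succ N ih =>
    obtain ⟨D, hD, hD'⟩ := ih
    obtain ⟨D₂, hD₂, hD₂'⟩ := hf.matrix_mul hD
    refine ⟨D₂, by simpa only [pow_succ'] using hD₂, fun h => ?_⟩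
    rw [hD₂', hD', Finset.sum_range_succ, Finset.mul_sum]
    congr 1
    · refine Finset.sum_congr rfl fun i hi => ?_
      have : N + 1 - 1 - i = N - 1 - i + 1 := by
        have := Finset.mem_range.mp hi
        lia
      rw [this, pow_succ']
      simp only [Matrix.mul_assoc]
    · simp

end Calculus

section Algebra

variable {m n R : Type*} [Fintype m] [Fintype n] [CommRing R]

theorem Matrix.IsSymm.sum_pow_mul_mul_pow [DecidableEq n] {A B : Matrix n n R} (hA : A.IsSymm) (hB : B.IsSymm)
    (N : ℕ) : (∑ i ∈ Finset.range N, B ^ i * A * B ^ (N - 1 - i)).IsSymm := by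
  rw [Matrix.IsSymm, transpose_sum, ← Finset.sum_range_reflect]
  refine Finset.sum_congr rfl fun i hi => ?_
  have : N - 1 - (N - 1 - i) = i := by
    have := Finset.mem_range.mp hi
    lia
  simp only [transpose_mul, transpose_pow, hA.eq, hB.eq, this, Matrix.mul_assoc]

theorem Matrix.trace_sum_pow_mul_mul_pow_mul [DecidableEq n] (A B C : Matrix n n R)
    (N : ℕ) :
    ((∑ i ∈ Finset.range N, B ^ (N - 1 - i) * C * B ^ i) * A).trace =
      ((∑ i ∈ Finset.range N, B ^ i * A * B ^ (N - 1 - i)) * C).trace := by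
  simp only [Finset.sum_mul, trace_sum]
  refine Finset.sum_congr rfl fun i _ => ?_
  rw [Matrix.mul_assoc, trace_mul_comm]
  simp only [Matrix.mul_assoc]

theorem Matrix.IsSymm.trace_mul_add_transpose {S : Matrix n n R} (hS : S.IsSymm)
    (V H : Matrix n m R) :
    (S * (V * Hᵀ + H * Vᵀ)).trace = 2 * ((S * V)ᵀ * H).trace := by
  have h₁ : (S * (V * Hᵀ)).trace = ((S * V)ᵀ * H).trace := by
    rw [← Matrix.mul_assoc, ← trace_transpose, transpose_mul, transpose_transpose, trace_mul_comm]
  have h₂ : (S * (H * Vᵀ)).trace = ((S * V)ᵀ * H).trace := by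
    rw [← Matrix.mul_assoc, trace_mul_comm, transpose_mul, hS.eq, Matrix.mul_assoc]
  rw [Matrix.mul_add, trace_add, h₁, h₂, two_mul]

end Algebra

/-- The derivative of `tr ((1 - V Vᵀ)^N A)` along a differentiable family of matrices `V`. -/
theorem HasFDerivAt.trace_one_sub_mul_transpose_pow_mul {m n E : Type*} [Fintype m] [Fintype n]
    [DecidableEq n] [NormedAddCommGroup E] [NormedSpace ℝ E] {V : E → Matrix n m ℝ} {x : E}
    {V' : E →L[ℝ] Matrix n m ℝ} (hV : HasFDerivAt V V' x) {A : Matrix n n ℝ} (hA : A.IsSymm)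
    (N : ℕ) :
    ∃ D : E →L[ℝ] ℝ, HasFDerivAt (fun y => ((1 - V y * (V y)ᵀ) ^ N * A).trace) D x ∧
      ∀ h, D h = (((-2 : ℝ) • ((∑ i ∈ Finset.range N,
        (1 - V x * (V x)ᵀ) ^ i * A * (1 - V x * (V x)ᵀ) ^ (N - 1 - i)) * V x))ᵀ * V' h).trace := by
  obtain ⟨T, hT, hT'⟩ := hV.matrix_transpose
  obtain ⟨M, hM, hM'⟩ := hV.matrix_mul hT
  obtain ⟨S, hS, hS'⟩ : ∃ S : E →L[ℝ] Matrix n n ℝ,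
      HasFDerivAt (fun y => 1 - V y * (V y)ᵀ) S x ∧
        ∀ h, S h = -(V x * (V' h)ᵀ + V' h * (V x)ᵀ) :=
    ⟨-M, hM.const_sub 1, fun h => by rw [← hT', ← hM']; rfl⟩
  obtain ⟨P, hP, hP'⟩ := hS.matrix_pow N
  obtain ⟨Q, hQ, hQ'⟩ := hP.matrix_mul (hasFDerivAt_const A x)
  obtain ⟨D, hD, hD'⟩ := hQ.matrix_trace
  refine ⟨D, hD, fun h => ?_⟩
  have hR : (1 - V x * (V x)ᵀ).IsSymm := by simp [Matrix.IsSymm]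
  have hQh : Q h = P h * A := by
    refine (hQ' h).trans ?_
    rw [show (0 : E →L[ℝ] Matrix n n ℝ) h = 0 from rfl, Matrix.mul_zero, zero_add]
  rw [hD', hQh, hP', hS', trace_sum_pow_mul_mul_pow_mul, Matrix.mul_neg, trace_neg,
    (hA.sum_pow_mul_mul_pow hR _).trace_mul_add_transpose]
  simp

/-- Gradient of the OMM-p trace functional: for a symmetric `A` and `p ≥ 1`, the
function `f(V) := tr((I_d − V Vᵀ)^{2p} A)` on `ℝ^{d×k}` is differentiable, and its
Fréchet derivative at `V` applied to `H` equals `tr(Gᵀ H)` with the gradient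
`G = −2 (Σ_{i=0}^{2p−1} R^i A R^{2p−1−i}) V`, where `R := I_d − V Vᵀ`; i.e. `G` is
the gradient of `f` with respect to the Frobenius inner product. -/
theorem ommp_gradient (d k p : ℕ) (hp : 1 ≤ p)
    (A : Matrix (Fin d) (Fin d) ℝ) (hA : A.IsSymm) :
    Differentiable ℝ
        (fun V : Matrix (Fin d) (Fin k) ℝ => (((1 - V * Vᵀ) ^ (2 * p)) * A).trace)
      ∧ ∀ V H : Matrix (Fin d) (Fin k) ℝ,
        fderiv ℝ
            (fun V : Matrix (Fin d) (Fin k) ℝ => (((1 - V * Vᵀ) ^ (2 * p)) * A).trace)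
            V H
          = (((-2 : ℝ) • ((∑ i ∈ Finset.range (2 * p),
                (1 - V * Vᵀ) ^ i * A * (1 - V * Vᵀ) ^ (2 * p - 1 - i)) * V))ᵀ
              * H).trace := by
  have key (V : Matrix (Fin d) (Fin k) ℝ) :=
    (hasFDerivAt_id (𝕜 := ℝ) V).trace_one_sub_mul_transpose_pow_mul hA (2 * p)
  refine ⟨fun V => (key V).choose_spec.1.differentiableAt, fun V H => ?_⟩
  obtain ⟨D, hD, hD'⟩ := key V
  exact (congrArg (· H) hD.fderiv).trans (hD' H)
end
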